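/- Let h ∈ C^∞(S¹, ℝ) act as a multiplication operator on L²(S¹) and let A be the self-adjoint operator on L²(S¹) that multiplies the n-th Fourier coefficient by n² + m², m > 0. Then there exist constants C_h, C_h' ≥ 0 such that ‖A^{1/4}(h·f)‖ ≤ C_h ‖A^{1/4} f‖ and ‖A^{−1/4}(h·f)‖ ≤ C_h' ‖A^{−1/4} f‖ for all f ∈ C^∞(S¹, ℝ); equivalently, A^{1/4} h A^{−1/4} and A^{−1/4} h A^{1/4} extend to bounded operators on L²(S¹). -/

import Mathlib

open Real Function

instance : Fact (0 < 2 * Real.pi) := ⟨by positivity⟩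

/-- The `n`-th Fourier coefficient of a `2π`-periodic real function, viewed as a
function on the circle `AddCircle (2π)`. -/
noncomputable def circCoeff (f : ℝ → ℝ) (hf : Function.Periodic f (2 * Real.pi))
    (n : ℤ) : ℂ :=
  fourierCoeff (T := 2 * Real.pi)
    ((hf.comp (fun r : ℝ => (r : ℂ))).lift) n

/-- The Fourier weight `(n² + m²)^α` of the powers `A^α` of the Klein-Gordon
operator `A = -d²/dθ² + m²` on `L²(S¹)`. -/
noncomputable def kgWeight (m : ℝ) (α : ℝ) (n : ℤ) : ℝ :=
  ((n : ℝ) ^ 2 + m ^ 2) ^ α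

section WeightedConvolution

/-- Cauchy–Schwarz for a summable nonnegative weight and a bounded sequence. -/
theorem sq_tsum_mul_le_tsum_mul_tsum_mul_sq {ι : Type*} {a x : ι → ℝ} {M : ℝ}
    (ha0 : ∀ k, 0 ≤ a k) (hx0 : ∀ k, 0 ≤ x k) (hxM : ∀ k, x k ≤ M) (ha : Summable a) :
    (∑' k, a k * x k) ^ 2 ≤ (∑' k, a k) * ∑' k, a k * x k ^ 2 := by
  have h1 : Summable fun k => a k * x k :=
    (ha.mul_right M).of_nonneg_of_le (fun k => mul_nonneg (ha0 k) (hx0 k))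
      fun k => mul_le_mul_of_nonneg_left (hxM k) (ha0 k)
  have h2 : Summable fun k => a k * x k ^ 2 :=
    (ha.mul_right (M ^ 2)).of_nonneg_of_le (fun k => mul_nonneg (ha0 k) (sq_nonneg _))
      fun k => mul_le_mul_of_nonneg_left (pow_le_pow_left₀ (hx0 k) (hxM k) 2) (ha0 k)
  have key : ∀ t : ℝ, 0 ≤ (∑' k, a k) * (t * t) + (-2 * ∑' k, a k * x k) * t
      + ∑' k, a k * x k ^ 2 := by
    intro t
    have hs := ((ha.hasSum.mul_right (t * t)).add
      ((h1.hasSum.mul_left (-2)).mul_right t)).add h2.hasSum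
    refine hs.nonneg fun k => ?_
    have := mul_nonneg (ha0 k) (sq_nonneg (x k - t))
    nlinarith
  have := discrim_le_zero key
  rw [discrim] at this
  nlinarith

/-- A convolution operator with kernel `a` is bounded on the weighted space `ℓ²(w)` as soon as
`w n ≤ P k * w (n - k)` and `∑ P k * ‖a k‖ < ∞`. -/
theorem tsum_weight_mul_sq_norm_convolution_le {w P : ℤ → ℝ} {a b c : ℤ → ℂ} {M : ℝ}
    (hw0 : ∀ n, 0 ≤ w n) (hP0 : ∀ k, 0 ≤ P k) (hwP : ∀ n k, w n ≤ P k * w (n - k))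
    (ha : Summable fun k => ‖a k‖) (hPa : Summable fun k => P k * ‖a k‖)
    (hb : ∀ n, ‖b n‖ ≤ M) (hwb : Summable fun n => w n * ‖b n‖ ^ 2)
    (hc : ∀ n, HasSum (fun k => a k * b (n - k)) (c n)) :
    ∑' n, w n * ‖c n‖ ^ 2 ≤
      ((∑' k, ‖a k‖) * ∑' k, P k * ‖a k‖) * ∑' n, w n * ‖b n‖ ^ 2 := by
  set F : ℤ × ℤ → ℝ := fun p => (P p.2 * ‖a p.2‖) * (w (p.1 - p.2) * ‖b (p.1 - p.2)‖ ^ 2) with hF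
  let G : ℤ × ℤ → ℝ := fun p => (P p.1 * ‖a p.1‖) * (w p.2 * ‖b p.2‖ ^ 2)
  let e : ℤ × ℤ ≃ ℤ × ℤ :=
    { toFun := fun p => (p.2, p.1 - p.2)
      invFun := fun p => (p.2 + p.1, p.1)
      left_inv := fun p => by ext <;> simp
      right_inv := fun p => by ext <;> simp }
  have hG : Summable G := hPa.mul_of_nonneg hwb
    (fun k => mul_nonneg (hP0 k) (norm_nonneg _)) fun n => mul_nonneg (hw0 n) (sq_nonneg _)
  have hFG : F = G ∘ e := rfl
  have hFs : Summable F := by rw [hFG]; exact e.summable_iff.2 hG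
  have hFsum : ∑' n, ∑' k, F (n, k) = (∑' k, P k * ‖a k‖) * ∑' n, w n * ‖b n‖ ^ 2 := by
    rw [← hFs.tsum_prod, hPa.tsum_mul_tsum hwb hG, hFG]
    exact e.tsum_eq G
  have hterm : ∀ n, w n * ‖c n‖ ^ 2 ≤ (∑' k, ‖a k‖) * ∑' k, F (n, k) := by
    intro n
    have hs1 : Summable fun k => ‖a k‖ * ‖b (n - k)‖ :=
      (ha.mul_right M).of_nonneg_of_le (fun k => by positivity)
        fun k => mul_le_mul_of_nonneg_left (hb _) (norm_nonneg _)
    have hs2 : Summable fun k => ‖a k‖ * ‖b (n - k)‖ ^ 2 :=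
      (ha.mul_right (M ^ 2)).of_nonneg_of_le (fun k => by positivity)
        fun k => mul_le_mul_of_nonneg_left
          (pow_le_pow_left₀ (norm_nonneg _) (hb _) 2) (norm_nonneg _)
    have hcn : ‖c n‖ ≤ ∑' k, ‖a k‖ * ‖b (n - k)‖ := by
      rw [← (hc n).tsum_eq]
      simp only [← norm_mul] at hs1 ⊢
      exact norm_tsum_le_tsum_norm hs1
    calc w n * ‖c n‖ ^ 2
        ≤ w n * ((∑' k, ‖a k‖) * ∑' k, ‖a k‖ * ‖b (n - k)‖ ^ 2) := by
          refine mul_le_mul_of_nonneg_left ?_ (hw0 n)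
          exact (pow_le_pow_left₀ (norm_nonneg _) hcn 2).trans
            (sq_tsum_mul_le_tsum_mul_tsum_mul_sq (fun _ => norm_nonneg _)
              (fun _ => norm_nonneg _) (fun k => hb (n - k)) ha)
      _ = (∑' k, ‖a k‖) * ∑' k, w n * (‖a k‖ * ‖b (n - k)‖ ^ 2) := by
          rw [tsum_mul_left]; ring
      _ ≤ (∑' k, ‖a k‖) * ∑' k, F (n, k) := by
          refine mul_le_mul_of_nonneg_left ?_ (tsum_nonneg fun _ => norm_nonneg _)
          refine (hs2.mul_left (w n)).tsum_le_tsum (fun k => ?_) (hFs.prod_factor n)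
          calc w n * (‖a k‖ * ‖b (n - k)‖ ^ 2)
              ≤ (P k * w (n - k)) * (‖a k‖ * ‖b (n - k)‖ ^ 2) :=
                mul_le_mul_of_nonneg_right (hwP n k) (by positivity)
            _ = F (n, k) := by simp only [hF]; ring
  have hR : Summable fun n => (∑' k, ‖a k‖) * ∑' k, F (n, k) := hFs.prod.mul_left _
  calc ∑' n, w n * ‖c n‖ ^ 2 ≤ ∑' n, (∑' k, ‖a k‖) * ∑' k, F (n, k) :=
        (hR.of_nonneg_of_le (fun n => mul_nonneg (hw0 n) (sq_nonneg _)) hterm).tsum_le_tsum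
          hterm hR
    _ = _ := by rw [tsum_mul_left, hFsum, mul_assoc]

end WeightedConvolution

section KleinGordonWeight

theorem kgWeight_nonneg (m α : ℝ) (n : ℤ) : 0 ≤ kgWeight m α n := by
  unfold kgWeight; positivity

/-- Peetre's inequality for the symbol of the Klein-Gordon operator. -/
theorem sq_add_sq_le_mul_sub_sq_add_sq {m : ℝ} (hm : 0 < m) (x y : ℝ) :
    x ^ 2 + m ^ 2 ≤ 2 * (1 + y ^ 2 / m ^ 2) * ((x - y) ^ 2 + m ^ 2) := by
  have h : 2 * (1 + y ^ 2 / m ^ 2) * ((x - y) ^ 2 + m ^ 2)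
      = 2 * (x - y) ^ 2 + 2 * m ^ 2 + 2 * y ^ 2 + 2 * (y ^ 2 / m ^ 2) * (x - y) ^ 2 := by
    field_simp; ring
  rw [h]
  have : 0 ≤ 2 * (y ^ 2 / m ^ 2) * (x - y) ^ 2 := by positivity
  nlinarith [sq_nonneg (x - 2 * y), sq_nonneg m]

theorem kgWeight_half_le_mul {m : ℝ} (hm : 0 < m) (n k : ℤ) :
    kgWeight m (1 / 2) n ≤ 2 * (1 + (k : ℝ) ^ 2 / m ^ 2) * kgWeight m (1 / 2) (n - k) := by
  have hQ : 1 ≤ 2 * (1 + (k : ℝ) ^ 2 / m ^ 2) := by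
    have : 0 ≤ (k : ℝ) ^ 2 / m ^ 2 := by positivity
    linarith
  unfold kgWeight
  push_cast
  calc ((n : ℝ) ^ 2 + m ^ 2) ^ (1 / 2 : ℝ)
      ≤ (2 * (1 + (k : ℝ) ^ 2 / m ^ 2) * (((n : ℝ) - k) ^ 2 + m ^ 2)) ^ (1 / 2 : ℝ) :=
        Real.rpow_le_rpow (by positivity) (sq_add_sq_le_mul_sub_sq_add_sq hm _ _) (by norm_num)
    _ = (2 * (1 + (k : ℝ) ^ 2 / m ^ 2)) ^ (1 / 2 : ℝ)
          * (((n : ℝ) - k) ^ 2 + m ^ 2) ^ (1 / 2 : ℝ) :=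
        Real.mul_rpow (by positivity) (by positivity)
    _ ≤ _ := mul_le_mul_of_nonneg_right
        (Real.rpow_le_self_of_one_le hQ (by norm_num)) (by positivity)

theorem kgWeight_neg_half_le_mul {m : ℝ} (hm : 0 < m) (n k : ℤ) :
    kgWeight m (-(1 / 2)) n ≤
      2 * (1 + (k : ℝ) ^ 2 / m ^ 2) * kgWeight m (-(1 / 2)) (n - k) := by
  have h := kgWeight_half_le_mul hm (n - k) (-k)
  rw [sub_neg_eq_add, sub_add_cancel] at h
  push_cast at h
  rw [neg_sq] at h
  have inv : ∀ j : ℤ, kgWeight m (-(1 / 2)) j = (kgWeight m (1 / 2) j)⁻¹ := fun j =>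
    Real.rpow_neg (by positivity) _
  have pos : ∀ j : ℤ, 0 < kgWeight m (1 / 2) j := fun j => by unfold kgWeight; positivity
  rw [inv, inv, ← div_eq_mul_inv, le_div_iff₀ (pos _), inv_mul_le_iff₀ (pos _), mul_comm]
  exact h

theorem kgWeight_half_le (m : ℝ) (n : ℤ) :
    kgWeight m (1 / 2) n ≤ 1 + m ^ 2 + (n : ℝ) ^ 2 := by
  unfold kgWeight
  have h1 : 1 ≤ 1 + m ^ 2 + (n : ℝ) ^ 2 := by nlinarith [sq_nonneg m, sq_nonneg (n : ℝ)]
  exact (Real.rpow_le_rpow (by positivity) (by linarith) (by norm_num)).trans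
    (Real.rpow_le_self_of_one_le h1 (by norm_num))

theorem kgWeight_neg_half_le {m : ℝ} (hm : 0 < m) (n : ℤ) :
    kgWeight m (-(1 / 2)) n ≤ kgWeight m (-(1 / 2)) 0 := by
  unfold kgWeight
  refine Real.rpow_le_rpow_of_nonpos (by positivity) ?_ (by norm_num)
  push_cast
  nlinarith [sq_nonneg (n : ℝ)]

end KleinGordonWeight

section FourierCoefficients

/-- The continuous function on the circle induced by a continuous periodic real function. -/
noncomputable def circLift (f : ℝ → ℝ) (hc : Continuous f)
    (hf : Function.Periodic f (2 * Real.pi)) : C(AddCircle (2 * Real.pi), ℂ) where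
  toFun := (hf.comp (fun r : ℝ => (r : ℂ))).lift
  continuous_toFun := continuous_coinduced_dom.mpr (Complex.continuous_ofReal.comp hc)

theorem circCoeff_eq_fourierCoeff_circLift (f : ℝ → ℝ) (hc : Continuous f)
    (hf : Function.Periodic f (2 * Real.pi)) (n : ℤ) :
    circCoeff f hf n = fourierCoeff (circLift f hc hf) n := rfl

theorem circLift_mul {f g : ℝ → ℝ} (hfc : Continuous f) (hgc : Continuous g)
    (hf : Function.Periodic f (2 * Real.pi)) (hg : Function.Periodic g (2 * Real.pi)) :
    circLift (fun x => f x * g x) (hfc.mul hgc) (hf.mul hg)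
      = circLift f hfc hf * circLift g hgc hg := by
  ext t
  induction t using QuotientAddGroup.induction_on with
  | H x => exact Complex.ofReal_mul _ _

theorem norm_fourierCoeff_le {T : ℝ} [Fact (0 < T)] (F : C(AddCircle T, ℂ)) (n : ℤ) :
    ‖fourierCoeff F n‖ ≤ ‖F‖ := by
  refine (MeasureTheory.norm_integral_le_of_norm_le_const (C := ‖F‖)
    (Filter.Eventually.of_forall fun t => ?_)).trans (by simp)
  rw [smul_eq_mul, norm_mul, fourier_apply, Circle.norm_coe, one_mul]
  exact F.norm_coe_le_norm t

theorem hasSum_fourierCoeff_mul {T : ℝ} [Fact (0 < T)] (F G : C(AddCircle T, ℂ))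
    (hF : Summable fun k => ‖fourierCoeff F k‖) (n : ℤ) :
    HasSum (fun k => fourierCoeff F k * fourierCoeff G (n - k)) (fourierCoeff (F * G) n) := by
  let H : ℤ → C(AddCircle T, ℂ) := fun k => fourier (-n) * ((fourierCoeff F k • fourier k) * G)
  have hH : ∀ k t, H k t = fourierCoeff F k * (fourier (-(n - k)) t • G t) := by
    intro k t
    have : (fourier (-(n - k)) t : ℂ) = fourier (-n) t * fourier k t := by
      rw [← fourier_add]; congr 2; ring
    simp only [H, ContinuousMap.mul_apply, ContinuousMap.smul_apply, smul_eq_mul, this]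
    ring
  have hnorm : ∀ k t, ‖H k t‖ ≤ ‖fourierCoeff F k‖ * ‖G‖ := by
    intro k t
    rw [hH, norm_mul, smul_eq_mul, norm_mul, fourier_apply, Circle.norm_coe, one_mul]
    exact mul_le_mul_of_nonneg_left (G.norm_coe_le_norm t) (norm_nonneg _)
  have hint : ∀ k, MeasureTheory.Integrable (H k) AddCircle.haarAddCircle := fun k =>
    (H k).continuous.integrable_of_hasCompactSupport (HasCompactSupport.of_compactSpace _)
  have hsum : Summable fun k => ∫ t, ‖H k t‖ ∂AddCircle.haarAddCircle := by
    refine (hF.mul_right ‖G‖).of_nonneg_of_le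
      (fun k => MeasureTheory.integral_nonneg fun t => norm_nonneg _) fun k => ?_
    refine (MeasureTheory.integral_mono (hint k).norm
      (MeasureTheory.integrable_const (‖fourierCoeff F k‖ * ‖G‖)) (hnorm k)).trans (by simp)
  have key := MeasureTheory.hasSum_integral_of_summable_integral_norm hint hsum
  have hl : ∀ k, ∫ t, H k t ∂AddCircle.haarAddCircle
      = fourierCoeff F k * fourierCoeff G (n - k) := fun k => by
    simp only [hH, fourierCoeff, MeasureTheory.integral_const_mul]
  have hr : ∫ t, ∑' k, H k t ∂AddCircle.haarAddCircle = fourierCoeff (F * G) n := by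
    refine MeasureTheory.integral_congr_ae (Filter.Eventually.of_forall fun t => ?_)
    exact (((has_pointwise_sum_fourier_series_of_summable hF.of_norm t).mul_right (G t)).mul_left
      (fourier (-n) t)).tsum_eq
  simpa only [hl, hr] using key

theorem circCoeff_eq_fourierCoeffOn (f : ℝ → ℝ) (hf : Function.Periodic f (2 * Real.pi))
    (n : ℤ) :
    circCoeff f hf n = fourierCoeffOn Real.two_pi_pos (fun x => (f x : ℂ)) n := by
  rw [circCoeff, fourierCoeff_eq_intervalIntegral _ n 0, fourierCoeffOn_eq_integral]
  simp only [zero_add, sub_zero]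
  congr 1
  refine intervalIntegral.integral_congr fun x _ => ?_
  simp only [fourier_coe_apply, sub_zero]
  rfl

theorem norm_circCoeff_deriv {f : ℝ → ℝ} (hfs : ContDiff ℝ (⊤ : ℕ∞) f)
    (hf : Function.Periodic f (2 * Real.pi)) (hf' : Function.Periodic (deriv f) (2 * Real.pi))
    (n : ℤ) : |(n : ℝ)| * ‖circCoeff f hf n‖ ≤ ‖circCoeff (deriv f) hf' n‖ := by
  rcases eq_or_ne n 0 with rfl | hn
  · simp
  have hc : Continuous (deriv f) := hfs.continuous_deriv (by exact_mod_cast le_top)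
  have hd : ∀ x, HasDerivAt (fun x => (f x : ℂ)) ((deriv f x : ℝ) : ℂ) x := fun x =>
    ((hfs.differentiable (by simp)) x).hasDerivAt.ofReal_comp
  have h0 : f (2 * Real.pi) = f 0 := by simpa using hf 0
  have hn' : |(n : ℝ)| ≠ 0 := by simpa using hn
  rw [circCoeff_eq_fourierCoeffOn, circCoeff_eq_fourierCoeffOn,
    fourierCoeffOn_of_hasDerivAt Real.two_pi_pos hn (fun x _ => hd x)
      ((Complex.continuous_ofReal.comp hc).intervalIntegrable _ _), h0]
  simp only [sub_self, mul_zero, zero_sub, norm_mul, norm_div, norm_neg, norm_one,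
    Complex.norm_I, Complex.norm_intCast, Complex.norm_ofNat, Complex.norm_real,
    Complex.ofReal_zero, sub_zero, Complex.ofReal_mul, Complex.ofReal_ofNat, Real.norm_eq_abs,
    abs_of_pos Real.pi_pos]
  have := Real.pi_pos
  apply le_of_eq
  field_simp

/-- The Fourier coefficients of a smooth function decay faster than any power. -/
theorem exists_abs_pow_mul_norm_circCoeff_le (j : ℕ) :
    ∀ (f : ℝ → ℝ) (_ : ContDiff ℝ (⊤ : ℕ∞) f) (hf : Function.Periodic f (2 * Real.pi)),
      ∃ M : ℝ, ∀ n : ℤ, |(n : ℝ)| ^ j * ‖circCoeff f hf n‖ ≤ M := by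
  induction j with
  | zero =>
    intro f hfs hf
    refine ⟨‖circLift f hfs.continuous hf‖, fun n => ?_⟩
    rw [pow_zero, one_mul, circCoeff_eq_fourierCoeff_circLift f hfs.continuous]
    exact norm_fourierCoeff_le _ n
  | succ j ih =>
    intro f hfs hf
    have hf' : Function.Periodic (deriv f) (2 * Real.pi) := fun x => by
      rw [← deriv_comp_add_const, hf.funext]
    obtain ⟨M, hM⟩ := ih (deriv f) (contDiff_infty_iff_deriv.1 hfs).2 hf'
    refine ⟨M, fun n => ?_⟩
    rw [pow_succ, mul_assoc]
    exact (mul_le_mul_of_nonneg_left (norm_circCoeff_deriv hfs hf hf' n) (by positivity)).trans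
      (hM n)

theorem summable_sq_mul_norm_circCoeff {f : ℝ → ℝ} (hfs : ContDiff ℝ (⊤ : ℕ∞) f)
    (hf : Function.Periodic f (2 * Real.pi)) :
    Summable fun n : ℤ => (n : ℝ) ^ 2 * ‖circCoeff f hf n‖ := by
  obtain ⟨M, hM⟩ := exists_abs_pow_mul_norm_circCoeff_le 4 f hfs hf
  refine ((Real.summable_one_div_int_pow (p := 2)).2 one_lt_two |>.mul_right M).of_nonneg_of_le
    (fun n => by positivity) fun n => ?_
  rcases eq_or_ne n 0 with rfl | hn
  · simp
  have hn' : 0 < (n : ℝ) ^ 2 := by positivity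
  rw [one_div, ← div_eq_inv_mul, le_div_iff₀ hn']
  refine le_trans (le_of_eq ?_) (hM n)
  rw [show |(n : ℝ)| ^ 4 = (n : ℝ) ^ 4 from (show Even 4 by decide).pow_abs _]
  ring

theorem summable_norm_circCoeff {f : ℝ → ℝ} (hfs : ContDiff ℝ (⊤ : ℕ∞) f)
    (hf : Function.Periodic f (2 * Real.pi)) :
    Summable fun n : ℤ => ‖circCoeff f hf n‖ := by
  refine (summable_sq_mul_norm_circCoeff hfs hf).of_norm_bounded_eventually ?_
  filter_upwards [(Set.finite_singleton (0 : ℤ)).compl_mem_cofinite] with n hn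
  have hn0 : n ≠ 0 := hn
  have h1 : (1 : ℝ) ≤ (n : ℝ) ^ 2 := by
    have : 0 < n ^ 2 := by positivity
    exact_mod_cast this
  rw [norm_norm]
  exact le_mul_of_one_le_left (norm_nonneg _) h1

theorem summable_add_mul_sq_mul_norm_circCoeff {f : ℝ → ℝ} (hfs : ContDiff ℝ (⊤ : ℕ∞) f)
    (hf : Function.Periodic f (2 * Real.pi)) (A B : ℝ) :
    Summable fun n : ℤ => (A + B * (n : ℝ) ^ 2) * ‖circCoeff f hf n‖ :=
  (((summable_norm_circCoeff hfs hf).mul_left A).add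
    ((summable_sq_mul_norm_circCoeff hfs hf).mul_left B)).congr fun n => by ring

theorem summable_weight_mul_norm_circCoeff_sq {f : ℝ → ℝ} (hfs : ContDiff ℝ (⊤ : ℕ∞) f)
    (hf : Function.Periodic f (2 * Real.pi)) {w : ℤ → ℝ} {A B : ℝ} (hw0 : ∀ n, 0 ≤ w n)
    (hw : ∀ n : ℤ, w n ≤ A + B * (n : ℝ) ^ 2) :
    Summable fun n : ℤ => w n * ‖circCoeff f hf n‖ ^ 2 := by
  obtain ⟨M, hM⟩ := exists_abs_pow_mul_norm_circCoeff_le 0 f hfs hf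
  refine ((summable_add_mul_sq_mul_norm_circCoeff hfs hf A B).mul_right M).of_nonneg_of_le
    (fun n => mul_nonneg (hw0 n) (sq_nonneg _)) fun n => ?_
  rw [sq, ← mul_assoc]
  have hMn : ‖circCoeff f hf n‖ ≤ M := by simpa using hM n
  exact mul_le_mul (mul_le_mul_of_nonneg_right (hw n) (norm_nonneg _)) hMn (norm_nonneg _)
    (mul_nonneg ((hw0 n).trans (hw n)) (norm_nonneg _))

/-- Multiplication by a smooth function is bounded for every weight of at most quadratic growth
satisfying a quadratic Peetre inequality. -/
theorem tsum_weight_mul_norm_circCoeff_mul_sq_le {h f : ℝ → ℝ}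
    (hh : ContDiff ℝ (⊤ : ℕ∞) h) (hper : Function.Periodic h (2 * Real.pi))
    (hfs : ContDiff ℝ (⊤ : ℕ∞) f) (hf : Function.Periodic f (2 * Real.pi))
    {w : ℤ → ℝ} {m A B : ℝ} (hw0 : ∀ n, 0 ≤ w n) (hw : ∀ n : ℤ, w n ≤ A + B * (n : ℝ) ^ 2)
    (hwP : ∀ n k : ℤ, w n ≤ 2 * (1 + (k : ℝ) ^ 2 / m ^ 2) * w (n - k)) :
    ∑' n : ℤ, w n * ‖circCoeff (fun x => h x * f x) (hper.mul hf) n‖ ^ 2 ≤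
      ((∑' k : ℤ, ‖circCoeff h hper k‖) *
        ∑' k : ℤ, 2 * (1 + (k : ℝ) ^ 2 / m ^ 2) * ‖circCoeff h hper k‖) *
      ∑' n : ℤ, w n * ‖circCoeff f hf n‖ ^ 2 := by
  obtain ⟨M, hM⟩ := exists_abs_pow_mul_norm_circCoeff_le 0 f hfs hf
  refine tsum_weight_mul_sq_norm_convolution_le (M := M) hw0 (fun k => by positivity) hwP
    (summable_norm_circCoeff hh hper) ?_ (fun n => by simpa using hM n)
    (summable_weight_mul_norm_circCoeff_sq hfs hf hw0 hw) fun n => ?_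
  · exact (summable_add_mul_sq_mul_norm_circCoeff hh hper 2 (2 / m ^ 2)).congr fun n => by ring
  · have := hasSum_fourierCoeff_mul (circLift h hh.continuous hper)
      (circLift f hfs.continuous hf) (summable_norm_circCoeff hh hper) n
    rwa [← circLift_mul] at this

end FourierCoefficients

/-- For a smooth real function `h` on the circle, acting by multiplication, the
operators `A^{1/4} h A^{-1/4}` and `A^{-1/4} h A^{1/4}` are bounded: there are
constants `C_h, C_h' ≥ 0` with `‖A^{1/4}(h·f)‖ ≤ C_h ‖A^{1/4} f‖` and
`‖A^{-1/4}(h·f)‖ ≤ C_h' ‖A^{-1/4} f‖` for all smooth real `f`, where the norms are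
computed via Parseval in the Fourier representation. -/
theorem multiplication_operator_bounded_conjugation
    (m : ℝ) (hm : 0 < m)
    (h : ℝ → ℝ) (hh : ContDiff ℝ (⊤ : ℕ∞) h) (hper : Function.Periodic h (2 * Real.pi)) :
    ∃ C C' : ℝ, 0 ≤ C ∧ 0 ≤ C' ∧
      ∀ (f : ℝ → ℝ) (hf : ContDiff ℝ (⊤ : ℕ∞) f)
        (hfper : Function.Periodic f (2 * Real.pi)),
        (∑' n : ℤ, kgWeight m (1 / 2) n *
            ‖circCoeff (fun x => h x * f x) (hper.mul hfper) n‖ ^ 2) ≤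
          C ^ 2 * ∑' n : ℤ, kgWeight m (1 / 2) n * ‖circCoeff f hfper n‖ ^ 2 ∧
        (∑' n : ℤ, kgWeight m (-(1 / 2)) n *
            ‖circCoeff (fun x => h x * f x) (hper.mul hfper) n‖ ^ 2) ≤
          C' ^ 2 * ∑' n : ℤ, kgWeight m (-(1 / 2)) n * ‖circCoeff f hfper n‖ ^ 2 := by
  set K : ℝ := (∑' k : ℤ, ‖circCoeff h hper k‖) *
    ∑' k : ℤ, 2 * (1 + (k : ℝ) ^ 2 / m ^ 2) * ‖circCoeff h hper k‖ with hK
  have hK0 : 0 ≤ K := mul_nonneg (tsum_nonneg fun _ => norm_nonneg _)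
    (tsum_nonneg fun _ => by positivity)
  refine ⟨√K, √K, Real.sqrt_nonneg _, Real.sqrt_nonneg _, fun f hf hfper => ?_⟩
  rw [Real.sq_sqrt hK0]
  exact ⟨tsum_weight_mul_norm_circCoeff_mul_sq_le hh hper hf hfper (kgWeight_nonneg m _)
      (A := 1 + m ^ 2) (B := 1) (fun n => by rw [one_mul]; exact kgWeight_half_le m n)
      (kgWeight_half_le_mul hm),
    tsum_weight_mul_norm_circCoeff_mul_sq_le hh hper hf hfper (kgWeight_nonneg m _)
      (A := kgWeight m (-(1 / 2)) 0) (B := 0)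
      (fun n => by rw [zero_mul, add_zero]; exact kgWeight_neg_half_le hm n)
      (kgWeight_neg_half_le_mul hm)⟩
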